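/- Aubin-type estimate for the solution map: let (ξ̄,x̄) ∈ graph Equi, ρ, γ, δ > 0, and suppose dist(x, Equi(ξ)) ≤ mf(ξ,x)/γ for all x ∈ ℝ^n and all ξ ∈ B̄(ξ̄,ρ). If moreover there exist ℓ > 0 and r ∈ (0,ρ] such that |mf(ξ₁,x) − mf(ξ₂,x)| ≤ ℓ‖ξ₁ − ξ₂‖ for all ξ₁, ξ₂ ∈ B̄(ξ̄,r) and all x ∈ B̄(x̄,δ), then for all ξ₁, ξ₂ ∈ B̄(ξ̄,r) one has sup_{x ∈ Equi(ξ₂) ∩ B̄(x̄,δ)} dist(x, Equi(ξ₁)) ≤ (ℓ/γ)‖ξ₁ − ξ₂‖, i.e. Equi has the Aubin (Lipschitz-like) property around (ξ̄,x̄). -/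

import Mathlib

/- STATEMENT 19: Aubin-type (Lipschitz-like) estimate for the solution map
   Equi, from the error bound and local Lipschitz continuity of ξ ↦ mf(ξ,x). -/

open Filter Topology Metric Set Pointwise ENNReal NNReal

noncomputable section

abbrev E (k : ℕ) := EuclideanSpace ℝ (Fin k)

/-- The auxiliary function ν, with values in `[0,+∞]`. -/
def nuF {p n m : ℕ} (f : E p → E n → E n → E m) (K : E p → Set (E n)) (C : Set (E m))
    (ξ : E p) (x : E n) : ℝ≥0∞ :=
  ⨆ z ∈ K ξ, EMetric.infEdist (f ξ x z) C

/-- The auxiliary merit function mf = ν + μ, with values in `[0,+∞]`. -/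
def mfF {p n m : ℕ} (f : E p → E n → E n → E m) (K : E p → Set (E n)) (C : Set (E m))
    (ξ : E p) (x : E n) : ℝ≥0∞ :=
  nuF f K C ξ x + EMetric.infEdist x (K ξ)

/-- The solution map of the parameterized strong vector equilibrium problem. -/
def equiSet {p n m : ℕ} (f : E p → E n → E n → E m) (K : E p → Set (E n)) (C : Set (E m))
    (ξ : E p) : Set (E n) :=
  {x ∈ K ξ | ∀ z ∈ K ξ, f ξ x z ∈ C}

/-- The merit function vanishes on the solution set. -/
theorem mfF_eq_zero_of_mem_equiSet {p n m : ℕ} {f : E p → E n → E n → E m}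
    {K : E p → Set (E n)} {C : Set (E m)} {ξ : E p} {x : E n} (hx : x ∈ equiSet f K C ξ) :
    mfF f K C ξ x = 0 := by
  have hν : nuF f K C ξ x = 0 := by
    simp only [nuF, ENNReal.iSup_eq_zero]
    exact fun z hz => Metric.infEDist_zero_of_mem (hx.2 z hz)
  rw [mfF, hν, zero_add]
  exact Metric.infEDist_zero_of_mem hx.1

theorem statement19 {p n m : ℕ}
    (K : E p → Set (E n)) (C : Set (E m)) (f : E p → E n → E n → E m)
    -- standing assumptions
    (hKgraph : IsClosed {q : E p × E n | q.2 ∈ K q.1})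
    (hKdom : ∀ ξ : E p, (K ξ).Nonempty)
    -- C is a nontrivial closed convex pointed cone
    (hCclosed : IsClosed C) (hCconv : Convex ℝ C)
    (hCcone : ∀ c ∈ C, ∀ t : ℝ, 0 ≤ t → t • c ∈ C)
    (hCpointed : C ∩ (-C) = {0}) (hCnontriv : C ≠ {0})
    (ξ' : E p) (x' : E n) (hbar : x' ∈ equiSet f K C ξ')
    (ρ γ δ : ℝ) (hρ : 0 < ρ) (hγ : 0 < γ) (hδ : 0 < δ)
    -- the error bound
    (herr : ∀ ξ ∈ Metric.closedBall ξ' ρ, ∀ x : E n,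
      EMetric.infEdist x (equiSet f K C ξ) ≤ mfF f K C ξ x / ENNReal.ofReal γ)
    -- local Lipschitz continuity of ξ ↦ mf(ξ,x), uniform in x ∈ B̄(x̄,δ)
    (ℓ r : ℝ) (hℓ : 0 < ℓ) (hr : 0 < r) (hrρ : r ≤ ρ)
    (hlip : ∀ ξ₁ ∈ Metric.closedBall ξ' r, ∀ ξ₂ ∈ Metric.closedBall ξ' r,
      ∀ x ∈ Metric.closedBall x' δ,
        mfF f K C ξ₁ x ≤ mfF f K C ξ₂ x + ENNReal.ofReal (ℓ * dist ξ₁ ξ₂)) :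
    -- Aubin-type estimate: sup_{x ∈ Equi(ξ₂) ∩ B̄(x̄,δ)} dist(x, Equi(ξ₁)) ≤ (ℓ/γ)‖ξ₁ − ξ₂‖
    ∀ ξ₁ ∈ Metric.closedBall ξ' r, ∀ ξ₂ ∈ Metric.closedBall ξ' r,
      ∀ x ∈ equiSet f K C ξ₂ ∩ Metric.closedBall x' δ,
        EMetric.infEdist x (equiSet f K C ξ₁) ≤ ENNReal.ofReal ((ℓ / γ) * dist ξ₁ ξ₂) := by
  rintro ξ₁ h₁ ξ₂ h₂ x ⟨hx, hxδ⟩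
  have hmf : mfF f K C ξ₁ x ≤ ENNReal.ofReal (ℓ * dist ξ₁ ξ₂) := by
    simpa [mfF_eq_zero_of_mem_equiSet hx] using hlip ξ₁ h₁ ξ₂ h₂ x hxδ
  refine (herr ξ₁ (Metric.closedBall_subset_closedBall hrρ h₁) x).trans ?_
  rw [div_mul_eq_mul_div, ENNReal.ofReal_div_of_pos hγ]
  exact ENNReal.div_le_div_right hmf _
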